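/- The LIP is equivalent to the (non-smooth) minimization problem min over h ∈ B_c ∩ K(ε) of η(h): the optimal value of this minimization equals the optimal value c* of the LIP, and h* is an optimal solution of min_{h ∈ B_c ∩ K(ε)} η(h) if and only if c*·h* is an optimal solution of the LIP. -/

import Mathlib

open scoped RealInnerProductSpace

noncomputable section

/- The function `e(h) = min_θ ‖x - θ·φ(h)‖²`. -/
open Classical in
def eFun {H : Type*} [NormedAddCommGroup H] [InnerProductSpace ℝ H] {n : ℕ}
    (φ : H →ₗ[ℝ] EuclideanSpace ℝ (Fin n)) (x : EuclideanSpace ℝ (Fin n)) (h : H) : ℝ :=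
  if φ h = 0 then ‖x‖ ^ 2 else ‖x‖ ^ 2 - (⟪x, φ h⟫) ^ 2 / ‖φ h‖ ^ 2

/- The convex cone `K(ε̄) = {h : ⟨x, φ h⟩ > 0 and e(h) ≤ ε̄²}`. -/
def Kcone {H : Type*} [NormedAddCommGroup H] [InnerProductSpace ℝ H] {n : ℕ}
    (φ : H →ₗ[ℝ] EuclideanSpace ℝ (Fin n)) (x : EuclideanSpace ℝ (Fin n)) (ebar : ℝ) :
    Set H :=
  {h | 0 < ⟪x, φ h⟫ ∧ eFun φ x h ≤ ebar ^ 2}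

/- The objective `η(h) = (‖x‖² - ε²)/(⟨x, φ h⟩ + ‖φ h‖·√(ε² - e(h)))`. -/
def etaFun {H : Type*} [NormedAddCommGroup H] [InnerProductSpace ℝ H] {n : ℕ}
    (φ : H →ₗ[ℝ] EuclideanSpace ℝ (Fin n)) (x : EuclideanSpace ℝ (Fin n)) (ε : ℝ)
    (h : H) : ℝ :=
  (‖x‖ ^ 2 - ε ^ 2) / (⟪x, φ h⟫ + ‖φ h‖ * Real.sqrt (ε ^ 2 - eFun φ x h))

section Feasibility

variable {H : Type*} [NormedAddCommGroup H] [InnerProductSpace ℝ H] {n : ℕ}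
  (φ : H →ₗ[ℝ] EuclideanSpace ℝ (Fin n)) (x : EuclideanSpace ℝ (Fin n))

theorem norm_sub_map_smul_le_iff {ε : ℝ} (hε : 0 ≤ ε) (t : ℝ) (h : H) :
    ‖x - φ (t • h)‖ ≤ ε ↔
      ‖x‖ ^ 2 - ε ^ 2 - 2 * t * ⟪x, φ h⟫ + t ^ 2 * ‖φ h‖ ^ 2 ≤ 0 := by
  rw [← sq_le_sq₀ (norm_nonneg _) hε, map_smul, norm_sub_sq_real, inner_smul_right, norm_smul,
    mul_pow, Real.norm_eq_abs, sq_abs]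
  constructor <;> intro h <;> linarith

theorem sq_norm_mul_eFun {h : H} (hh : φ h ≠ 0) :
    ‖φ h‖ ^ 2 * eFun φ x h = ‖x‖ ^ 2 * ‖φ h‖ ^ 2 - ⟪x, φ h⟫ ^ 2 := by
  have hb : ‖φ h‖ ≠ 0 := norm_ne_zero_iff.mpr hh
  rw [eFun, if_neg hh]
  field_simp

theorem map_ne_zero_of_inner_pos {h : H} (ha : 0 < ⟪x, φ h⟫) : φ h ≠ 0 := by
  intro h0
  simp [h0] at ha

theorem sq_norm_mul_sqrt {ε : ℝ} {h : H} (hh : h ∈ Kcone φ x ε) :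
    (‖φ h‖ * √(ε ^ 2 - eFun φ x h)) ^ 2 =
      ⟪x, φ h⟫ ^ 2 - ‖φ h‖ ^ 2 * (‖x‖ ^ 2 - ε ^ 2) := by
  rw [mul_pow, Real.sq_sqrt (sub_nonneg.mpr hh.2), mul_sub,
    sq_norm_mul_eFun φ x (map_ne_zero_of_inner_pos φ x hh.1)]
  ring

theorem etaFun_denom_pos {ε : ℝ} {h : H} (hh : h ∈ Kcone φ x ε) :
    0 < ⟪x, φ h⟫ + ‖φ h‖ * √(ε ^ 2 - eFun φ x h) :=
  add_pos_of_pos_of_nonneg hh.1 (by positivity)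

theorem etaFun_pos {ε : ℝ} (hε : 0 ≤ ε) (hx : ε < ‖x‖) {h : H} (hh : h ∈ Kcone φ x ε) :
    0 < etaFun φ x ε h :=
  div_pos (sub_pos.mpr (pow_lt_pow_left₀ hx hε two_ne_zero)) (etaFun_denom_pos φ x hh)

theorem norm_sub_map_etaFun_smul_le {ε : ℝ} (hε : 0 ≤ ε) {h : H} (hh : h ∈ Kcone φ x ε) :
    ‖x - φ (etaFun φ x ε h • h)‖ ≤ ε := by
  rw [norm_sub_map_smul_le_iff φ x hε, etaFun]
  have hw := sq_norm_mul_sqrt φ x hh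
  have hp := etaFun_denom_pos φ x hh
  set w := ‖φ h‖ * √(ε ^ 2 - eFun φ x h)
  set D := ‖x‖ ^ 2 - ε ^ 2
  apply le_of_eq
  field_simp
  linear_combination D * hw

theorem mem_Kcone_of_norm_sub_map_smul_le {ε t : ℝ} (hε : 0 ≤ ε) (hx : ε < ‖x‖) (ht : 0 ≤ t)
    {h : H} (hf : ‖x - φ (t • h)‖ ≤ ε) : h ∈ Kcone φ x ε := by
  rw [norm_sub_map_smul_le_iff φ x hε] at hf
  have hD : 0 < ‖x‖ ^ 2 - ε ^ 2 := sub_pos.mpr (pow_lt_pow_left₀ hx hε two_ne_zero)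
  have hta : 0 < t * ⟪x, φ h⟫ := by nlinarith [sq_nonneg (t * ‖φ h‖)]
  have ha : 0 < ⟪x, φ h⟫ := pos_of_mul_pos_right hta ht
  have h0 := map_ne_zero_of_inner_pos φ x ha
  have hb : 0 < ‖φ h‖ ^ 2 := by positivity
  refine ⟨ha, le_of_mul_le_mul_left ?_ hb⟩
  rw [sq_norm_mul_eFun φ x h0]
  nlinarith [mul_nonpos_of_nonneg_of_nonpos hb.le hf, sq_nonneg (t * ‖φ h‖ ^ 2 - ⟪x, φ h⟫)]

theorem etaFun_le_of_norm_sub_map_smul_le {ε t : ℝ} (hε : 0 ≤ ε) (hx : ε < ‖x‖) (ht : 0 ≤ t)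
    {h : H} (hf : ‖x - φ (t • h)‖ ≤ ε) : etaFun φ x ε h ≤ t := by
  have hh := mem_Kcone_of_norm_sub_map_smul_le φ x hε hx ht hf
  rw [norm_sub_map_smul_le_iff φ x hε] at hf
  have hw := sq_norm_mul_sqrt φ x hh
  rw [etaFun, div_le_iff₀ (etaFun_denom_pos φ x hh)]
  have hw0 : 0 ≤ ‖φ h‖ * √(ε ^ 2 - eFun φ x h) := by positivity
  set w := ‖φ h‖ * √(ε ^ 2 - eFun φ x h)
  have hle : ⟪x, φ h⟫ - t * ‖φ h‖ ^ 2 ≤ w := by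
    refine (abs_le_of_sq_le_sq' ?_ hw0).2
    rw [hw]
    nlinarith [mul_nonpos_of_nonneg_of_nonpos (sq_nonneg ‖φ h‖) hf]
  nlinarith [mul_le_mul_of_nonneg_left hle ht]

end Feasibility

theorem pos_of_isCompact_sublevel {H : Type*} [NormedAddCommGroup H] [NormedSpace ℝ H]
    {c : H → ℝ} (hhom : ∀ r : ℝ, 0 ≤ r → ∀ f : H, c (r • f) = r * c f)
    (hcpt : IsCompact {f : H | c f ≤ 1}) {f : H} (hf : f ≠ 0) : 0 < c f := by
  by_contra! hc
  obtain ⟨M, hM⟩ := hcpt.isBounded.exists_norm_le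
  have hf' : 0 < ‖f‖ := norm_pos_iff.mpr hf
  have hr : 0 ≤ (|M| + 1) / ‖f‖ := by positivity
  have hle := hM (((|M| + 1) / ‖f‖) • f) (by
    rw [Set.mem_ofPred_eq, hhom _ hr]
    nlinarith [mul_nonpos_of_nonneg_of_nonpos hr hc])
  rw [norm_smul, Real.norm_of_nonneg hr, div_mul_cancel₀ _ hf'.ne'] at hle
  linarith [le_abs_self M]

/- STATEMENT 18: the LIP is equivalent to minimizing `η` over `B_c ∩ K(ε)`: the
optimal value equals `c*`, and `h*` solves `min_{h ∈ B_c ∩ K(ε)} η(h)` iff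
`c* • h*` is an optimal solution of the LIP. -/
theorem stmt18 {H : Type*} [NormedAddCommGroup H] [InnerProductSpace ℝ H]
    [FiniteDimensional ℝ H] {n : ℕ}
    (φ : H →ₗ[ℝ] EuclideanSpace ℝ (Fin n)) (x : EuclideanSpace ℝ (Fin n))
    (ε : ℝ) (hε : 0 < ε) (hx : ε < ‖x‖)
    (c : H → ℝ)
    (hhom : ∀ r : ℝ, 0 ≤ r → ∀ f : H, c (r • f) = r * c f)
    (hcpt : IsCompact {f : H | c f ≤ 1})
    (hcvx : Convex ℝ {f : H | c f ≤ 1})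
    (hfeas : ∃ f : H, ‖x - φ f‖ < ε)
    (cstar : ℝ)
    (hcstar : IsLeast {y : ℝ | ∃ f : H, ‖x - φ f‖ ≤ ε ∧ c f = y} cstar) :
    sInf (etaFun φ x ε '' ({g : H | c g ≤ 1} ∩ Kcone φ x ε)) = cstar ∧
    (∀ hstar : H,
      (hstar ∈ {g : H | c g ≤ 1} ∩ Kcone φ x ε ∧
        ∀ h ∈ {g : H | c g ≤ 1} ∩ Kcone φ x ε,
          etaFun φ x ε hstar ≤ etaFun φ x ε h) ↔
      (‖x - φ (cstar • hstar)‖ ≤ ε ∧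
        ∀ f : H, ‖x - φ f‖ ≤ ε → c (cstar • hstar) ≤ c f)) := by
  have hpos : ∀ f : H, ‖x - φ f‖ ≤ ε → 0 < c f := fun f hf => by
    refine pos_of_isCompact_sublevel hhom hcpt ?_
    rintro rfl
    rw [map_zero, sub_zero] at hf
    exact hx.not_ge hf
  obtain ⟨⟨f₀, hf₀, hcf₀⟩, hlb⟩ := hcstar
  have hmin : ∀ f : H, ‖x - φ f‖ ≤ ε → cstar ≤ c f := fun f hf => hlb ⟨f, hf, rfl⟩
  have hcs : 0 < cstar := hcf₀ ▸ hpos f₀ hf₀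
  have hle : ∀ h ∈ {g : H | c g ≤ 1} ∩ Kcone φ x ε, cstar ≤ etaFun φ x ε h := by
    rintro h ⟨hc, hK⟩
    have hη := etaFun_pos φ x hε.le hx hK
    have hle := hmin _ (norm_sub_map_etaFun_smul_le φ x hε.le hK)
    rw [hhom _ hη.le] at hle
    exact hle.trans (mul_le_of_le_one_right hη.le hc)
  have hsol : ∀ h : H, c h ≤ 1 → ‖x - φ (cstar • h)‖ ≤ ε →
      h ∈ {g : H | c g ≤ 1} ∩ Kcone φ x ε ∧ etaFun φ x ε h = cstar := by
    intro h hc hf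
    have hmem : h ∈ {g : H | c g ≤ 1} ∩ Kcone φ x ε :=
      ⟨hc, mem_Kcone_of_norm_sub_map_smul_le φ x hε.le hx hcs.le hf⟩
    exact ⟨hmem, (etaFun_le_of_norm_sub_map_smul_le φ x hε.le hx hcs.le hf).antisymm
      (hle h hmem)⟩
  obtain ⟨hmem₀, hη₀⟩ := hsol (cstar⁻¹ • f₀)
    (by rw [hhom _ (inv_nonneg.mpr hcs.le), hcf₀, inv_mul_cancel₀ hcs.ne'])
    (by rwa [smul_inv_smul₀ hcs.ne'])
  refine ⟨IsLeast.csInf_eq ⟨⟨_, hmem₀, hη₀⟩, Set.forall_mem_image.mpr hle⟩, fun h => ⟨?_, ?_⟩⟩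
  · rintro ⟨hmem, hopt⟩
    have hη : etaFun φ x ε h = cstar := ((hopt _ hmem₀).trans_eq hη₀).antisymm (hle h hmem)
    refine ⟨hη ▸ norm_sub_map_etaFun_smul_le φ x hε.le hmem.2, fun f hf => ?_⟩
    rw [hhom _ hcs.le]
    exact (mul_le_of_le_one_right hcs.le hmem.1).trans (hmin f hf)
  · rintro ⟨hf, hopt⟩
    have hc : c h ≤ 1 := by
      have := hopt f₀ hf₀
      rw [hhom _ hcs.le, hcf₀] at this
      exact (mul_le_iff_le_one_right hcs).mp this
    obtain ⟨hmem, hη⟩ := hsol h hc hf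
    exact ⟨hmem, fun g hg => hη.trans_le (hle g hg)⟩
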